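/- There exist constants δ₀ > 0 and γ₁ > 0 such that every Q ∈ Sym₀ with dist(Q, N) ≤ δ₀ satisfies f(Q) ≥ γ₁ · dist(Q, N)², where dist(Q, N) = inf over P ∈ N of |Q − P|. -/

import Mathlib

open Matrix

noncomputable section

/-- The space `Sym₀` of symmetric traceless `3 × 3` real matrices (as a subset of matrices). -/
def Sym0 : Set (Matrix (Fin 3) (Fin 3) ℝ) := {Q | Q.IsSymm ∧ Q.trace = 0}

/-- The norm `|Q| = √(tr Q²)`. -/
def nrm (Q : Matrix (Fin 3) (Fin 3) ℝ) : ℝ := Real.sqrt ((Q * Q).trace)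

/-- The Landau-de Gennes bulk potential
`f(Q) = C - a/2 tr(Q²) - b/3 tr(Q³) + c/4 (tr(Q²))²`. -/
def fLdG (a b c C : ℝ) (Q : Matrix (Fin 3) (Fin 3) ℝ) : ℝ :=
  C - a / 2 * (Q * Q).trace - b / 3 * (Q * Q * Q).trace + c / 4 * ((Q * Q).trace) ^ 2

/-- `s* = (b + √(b² + 24 a c))/(4c)`. -/
def sstar (a b c : ℝ) : ℝ := (b + Real.sqrt (b ^ 2 + 24 * a * c)) / (4 * c)

/-- The matrix `n ⊗ n` with entries `nᵢ nⱼ`. -/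
def outer (n : Fin 3 → ℝ) : Matrix (Fin 3) (Fin 3) ℝ := Matrix.of fun i j => n i * n j

/-- `n` is a unit vector of `ℝ³`. -/
def unitVec (n : Fin 3 → ℝ) : Prop := n 0 ^ 2 + n 1 ^ 2 + n 2 ^ 2 = 1

/-- The uniaxial matrix `s (n ⊗ n - Id/3)`. -/
def uniax (s : ℝ) (n : Fin 3 → ℝ) : Matrix (Fin 3) (Fin 3) ℝ :=
  s • (outer n - (1 / 3 : ℝ) • (1 : Matrix (Fin 3) (Fin 3) ℝ))

/-- The vacuum manifold `N = { s* (n ⊗ n - Id/3) : n ∈ S² }`. -/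
def Nset (a b c : ℝ) : Set (Matrix (Fin 3) (Fin 3) ℝ) :=
  {Q | ∃ n : Fin 3 → ℝ, unitVec n ∧ Q = uniax (sstar a b c) n}

/-- The distance `dist(Q, N) = inf_{P ∈ N} |Q - P|` measured in the norm `|·| = √(tr(·²))`. -/
def distN (a b c : ℝ) (Q : Matrix (Fin 3) (Fin 3) ℝ) : ℝ :=
  sInf ((fun P => nrm (Q - P)) '' Nset a b c)

theorem outer_eq_vecMulVec (n : Fin 3 → ℝ) : outer n = vecMulVec n n := rfl

theorem unitVec.dotProduct_self {n : Fin 3 → ℝ} (hn : unitVec n) : n ⬝ᵥ n = 1 := by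
  unfold unitVec at hn
  simp only [dotProduct, Fin.sum_univ_three]
  linarith

theorem unitVec.trace_outer {n : Fin 3 → ℝ} (hn : unitVec n) : (outer n).trace = 1 := by
  rw [outer_eq_vecMulVec, trace_vecMulVec, hn.dotProduct_self]

theorem unitVec.outer_mul_outer {n : Fin 3 → ℝ} (hn : unitVec n) :
    outer n * outer n = outer n := by
  rw [outer_eq_vecMulVec, vecMulVec_mul_vecMulVec, hn.dotProduct_self, one_smul]

theorem outer_isSymm (n : Fin 3 → ℝ) : (outer n).IsSymm := by
  ext i j
  simp [outer, mul_comm]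

theorem uniax_isSymm (s : ℝ) (n : Fin 3 → ℝ) : (uniax s n).IsSymm :=
  ((outer_isSymm n).sub (isSymm_one.smul _)).smul s

theorem trace_mul_self_nonneg {M : Matrix (Fin 3) (Fin 3) ℝ} (hM : M.IsSymm) :
    0 ≤ (M * M).trace := by
  nth_rewrite 1 [← hM.eq]
  simp only [trace, diag, mul_apply, transpose_apply]
  exact Finset.sum_nonneg fun i _ => Finset.sum_nonneg fun j _ => mul_self_nonneg _

theorem trace_mul_outer (M : Matrix (Fin 3) (Fin 3) ℝ) (n : Fin 3 → ℝ) :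
    (M * outer n).trace = n ⬝ᵥ M *ᵥ n := by
  rw [outer_eq_vecMulVec, mul_vecMulVec, trace_vecMulVec, dotProduct_comm]

theorem trace_sub_smul_outer_sq (M : Matrix (Fin 3) (Fin 3) ℝ) {n : Fin 3 → ℝ}
    (hn : unitVec n) (t : ℝ) :
    ((M - t • outer n) * (M - t • outer n)).trace =
      (M * M).trace - 2 * t * (n ⬝ᵥ M *ᵥ n) + t ^ 2 := by
  simp only [sub_mul, mul_sub, smul_mul_assoc, mul_smul_comm, trace_sub, trace_smul,
    hn.outer_mul_outer, hn.trace_outer, trace_mul_comm (outer n) M, trace_mul_outer, smul_eq_mul]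
  ring

theorem abs_dotProduct_mulVec_le_nrm {M : Matrix (Fin 3) (Fin 3) ℝ} (hM : M.IsSymm)
    {n : Fin 3 → ℝ} (hn : unitVec n) : |n ⬝ᵥ M *ᵥ n| ≤ nrm M := by
  have h := trace_mul_self_nonneg (hM.sub ((outer_isSymm n).smul (n ⬝ᵥ M *ᵥ n)))
  rw [trace_sub_smul_outer_sq M hn] at h
  exact Real.abs_le_sqrt (by linarith)

theorem trace_sub_uniax_sq {Q : Matrix (Fin 3) (Fin 3) ℝ} (hQ : Q.trace = 0)
    {n : Fin 3 → ℝ} (hn : unitVec n) (s : ℝ) :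
    ((Q - uniax s n) * (Q - uniax s n)).trace =
      (Q * Q).trace - 2 * s * (n ⬝ᵥ Q *ᵥ n) + 2 / 3 * s ^ 2 := by
  simp only [uniax, sub_mul, mul_sub, smul_mul_assoc, mul_smul_comm, trace_sub, trace_smul,
    hn.outer_mul_outer, hn.trace_outer, trace_mul_comm (outer n) Q, trace_mul_outer, smul_eq_mul,
    mul_one, one_mul, hQ, trace_one, Fintype.card_fin, smul_sub]
  norm_num
  ring

theorem dotProduct_uniax_mulVec {n : Fin 3 → ℝ} (hn : unitVec n) (s : ℝ) :
    n ⬝ᵥ uniax s n *ᵥ n = 2 / 3 * s := by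
  rw [← trace_mul_outer]
  simp only [uniax, sub_mul, smul_mul_assoc, one_mul, trace_sub, trace_smul,
    hn.outer_mul_outer, hn.trace_outer, smul_eq_mul]
  ring

theorem uniax_mem_Sym0 {n : Fin 3 → ℝ} (hn : unitVec n) (s : ℝ) : uniax s n ∈ Sym0 := by
  refine ⟨uniax_isSymm s n, ?_⟩
  simp [uniax, trace_sub, trace_smul, hn.trace_outer]

/-- The Cayley-Hamilton relation for traceless matrices, at an eigenvalue `x`. -/
theorem trace_cube_of_mulVec_eq_smul {Q : Matrix (Fin 3) (Fin 3) ℝ} (hQ : Q.trace = 0)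
    {n : Fin 3 → ℝ} (hn : n ≠ 0) {x : ℝ} (hx : Q *ᵥ n = x • n) :
    (Q * Q * Q).trace = 3 * x ^ 3 - 3 / 2 * (Q * Q).trace * x := by
  have hdet : (Q - x • (1 : Matrix (Fin 3) (Fin 3) ℝ)).det = 0 :=
    exists_mulVec_eq_zero_iff.mp ⟨n, hn, by simp [sub_mulVec, smul_mulVec, hx]⟩
  have h2 : Q 2 2 = -Q 0 0 - Q 1 1 := by
    simp only [trace, diag, Fin.sum_univ_three] at hQ
    linarith
  simp [det_fin_three, h2] at hdet
  simp only [trace, diag, mul_apply, Fin.sum_univ_three, h2]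
  linear_combination 3 * hdet

/-- A symmetric matrix has an eigenvalue at least as large as any given Rayleigh quotient. -/
theorem exists_eigenvector_ge {Q : Matrix (Fin 3) (Fin 3) ℝ} (hQ : Q.IsSymm)
    {m : Fin 3 → ℝ} (hm : unitVec m) :
    ∃ n : Fin 3 → ℝ, unitVec n ∧ ∃ x : ℝ, m ⬝ᵥ Q *ᵥ m ≤ x ∧ Q *ᵥ n = x • n := by
  set t := m ⬝ᵥ Q *ᵥ m with ht
  have hA : (t • (1 : Matrix (Fin 3) (Fin 3) ℝ) - Q).IsHermitian := by
    have h := (isSymm_one (n := Fin 3) (α := ℝ)).smul t |>.sub hQ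
    rw [IsHermitian, conjTranspose_eq_transpose_of_trivial, h.eq]
  have hnot : ¬ ∀ i, 0 < hA.eigenvalues i := fun h => by
    have hm0 : m ≠ 0 := by
      rintro rfl
      simp [unitVec] at hm
    have h1 := (hA.posDef_iff_eigenvalues_pos.mpr h).dotProduct_mulVec_pos hm0
    simp [sub_mulVec, smul_mulVec, dotProduct_sub, hm.dotProduct_self, ← ht] at h1
  push Not at hnot
  obtain ⟨i, hi⟩ := hnot
  refine ⟨hA.eigenvectorBasis i, ?_, t - hA.eigenvalues i, by linarith, ?_⟩
  · have h := hA.eigenvectorBasis.orthonormal.1 i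
    rw [EuclideanSpace.norm_eq, Real.sqrt_eq_one] at h
    simpa [unitVec, Fin.sum_univ_three] using h
  · have h := hA.mulVec_eigenvectorBasis i
    rw [sub_mulVec, smul_mulVec, one_mulVec] at h
    rw [sub_smul, ← h]
    abel

theorem nrm_sq {M : Matrix (Fin 3) (Fin 3) ℝ} (hM : M.IsSymm) : nrm M ^ 2 = (M * M).trace :=
  Real.sq_sqrt (trace_mul_self_nonneg hM)

theorem distN_nonneg (a b c : ℝ) (Q : Matrix (Fin 3) (Fin 3) ℝ) : 0 ≤ distN a b c Q :=
  Real.sInf_nonneg (by rintro _ ⟨P, -, rfl⟩; exact Real.sqrt_nonneg _)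

theorem distN_le (a b c : ℝ) (Q : Matrix (Fin 3) (Fin 3) ℝ) {n : Fin 3 → ℝ} (hn : unitVec n) :
    distN a b c Q ≤ nrm (Q - uniax (sstar a b c) n) :=
  csInf_le ⟨0, by rintro _ ⟨P, -, rfl⟩; exact Real.sqrt_nonneg _⟩ ⟨_, ⟨n, hn, rfl⟩, rfl⟩

theorem unitVec_basis : unitVec ![1, 0, 0] := by simp [unitVec]

theorem exists_nrm_sub_uniax_lt {a b c r : ℝ} {Q : Matrix (Fin 3) (Fin 3) ℝ}
    (h : distN a b c Q < r) : ∃ m, unitVec m ∧ nrm (Q - uniax (sstar a b c) m) < r := by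
  have hne : (Nset a b c).Nonempty := ⟨_, _, unitVec_basis, rfl⟩
  obtain ⟨_, ⟨_, ⟨m, hm, rfl⟩, rfl⟩, hlt⟩ := exists_lt_of_csInf_lt (hne.image _) h
  exact ⟨m, hm, hlt⟩

/-- The potential in terms of an eigenvalue `x` and `T = tr(Q²)`. -/
theorem fLdG_of_mulVec_eq_smul (a b c C : ℝ) {Q : Matrix (Fin 3) (Fin 3) ℝ} (hQ : Q.trace = 0)
    {n : Fin 3 → ℝ} (hn : unitVec n) {x : ℝ} (hx : Q *ᵥ n = x • n) :
    fLdG a b c C Q = C - a / 2 * (Q * Q).trace - b * (x ^ 3 - (Q * Q).trace * x / 2) +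
      c / 4 * (Q * Q).trace ^ 2 := by
  have hn0 : n ≠ 0 := by
    rintro rfl
    simp [unitVec] at hn
  rw [fLdG, trace_cube_of_mulVec_eq_smul hQ hn0 hx]
  ring

theorem sstar_pos {a b c : ℝ} (hb : 0 < b) (hc : 0 < c) : 0 < sstar a b c := by
  unfold sstar
  positivity

theorem sstar_quadratic {a b c : ℝ} (ha : 0 < a) (hc : 0 < c) :
    2 * c * sstar a b c ^ 2 = b * sstar a b c + 3 * a := by
  have h : Real.sqrt (b ^ 2 + 24 * a * c) ^ 2 = b ^ 2 + 24 * a * c :=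
    Real.sq_sqrt (by positivity)
  unfold sstar
  generalize Real.sqrt (b ^ 2 + 24 * a * c) = r at h ⊢
  field_simp
  linear_combination 2 * h

theorem uniax_mulVec {n : Fin 3 → ℝ} (hn : unitVec n) (s : ℝ) :
    uniax s n *ᵥ n = (2 / 3 * s) • n := by
  simp only [uniax, outer_eq_vecMulVec, smul_mulVec, sub_mulVec, vecMulVec_mulVec,
    hn.dotProduct_self, one_mulVec, MulOpposite.op_one, one_smul]
  module

theorem trace_uniax_sq {n : Fin 3 → ℝ} (hn : unitVec n) (s : ℝ) :
    (uniax s n * uniax s n).trace = 2 / 3 * s ^ 2 := by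
  simpa using trace_sub_uniax_sq (Q := 0) (by simp) hn s

/-- The scalar lower bound behind the coercivity estimate: `x` plays the role of the largest
eigenvalue, `T` that of `tr(Q²)`, and `2 * s / 3` that of the largest eigenvalue on `N`. -/
theorem scalar_lower_bound {a b c C s x T h : ℝ} (hb : 0 < b) (hc : 0 < c) (hs : 0 < s)
    (hq : 2 * c * s ^ 2 = b * s + 3 * a) (ha : 0 < a)
    (hC : 0 ≤ C - a / 2 * (2 / 3 * s ^ 2) - b / 3 * (2 / 9 * s ^ 3) + c / 4 * (2 / 3 * s ^ 2) ^ 2)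
    (hT : 3 / 2 * x ^ 2 ≤ T) (hh : h * (b + 2 * c * s) = b * s / 3) (hx : 2 / 3 * s - h ≤ x) :
    min (s * (3 * c * s - b) / 18) (b * s / 3) * (T - 2 * s * x + 2 / 3 * s ^ 2) ≤
      C - a / 2 * T - b * (x ^ 3 - T * x / 2) + c / 4 * T ^ 2 := by
  have hβ : 0 < 3 * c * s - b := by
    have : 0 < s * (3 * c * s - b) := by nlinarith [mul_pos hb hs]
    exact pos_of_mul_pos_right this hs.le
  have hhs : h ≤ s / 3 := by
    by_contra! hlt
    nlinarith [mul_lt_mul_of_pos_right hlt (by positivity : 0 < b + 2 * c * s), mul_pos hc hs,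
      mul_pos (mul_pos hc hs) hs]
  have hx0 : 0 ≤ x := by linarith
  obtain ⟨y, rfl⟩ : ∃ y, T = 3 / 2 * x ^ 2 + 2 * y := ⟨(T - 3 / 2 * x ^ 2) / 2, by ring⟩
  have hy : 0 ≤ y := by linarith
  have hg : 2 / 3 * b * s ≤ -a + b * x + 3 / 2 * c * x ^ 2 := by
    have h1 : 0 ≤ (x - (2 / 3 * s - h)) * (b + 2 * c * s) :=
      mul_nonneg (by linarith) (by positivity)
    nlinarith [mul_nonneg hc.le (sq_nonneg (x - 2 / 3 * s))]
  have hγ₁ := min_le_left (s * (3 * c * s - b) / 18) (b * s / 3)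
  have hγ₂ := min_le_right (s * (3 * c * s - b) / 18) (b * s / 3)
  generalize min (s * (3 * c * s - b) / 18) (b * s / 3) = γ at hγ₁ hγ₂ ⊢
  have e₁ := mul_le_mul_of_nonneg_right hγ₁ (sq_nonneg (x - 2 / 3 * s))
  have e₂ := mul_le_mul_of_nonneg_right hγ₂ hy
  have e₃ := mul_le_mul_of_nonneg_right hg hy
  have e₄ : 0 ≤ (x - 2 / 3 * s) ^ 2 * (9 / 16 * c * x ^ 2 + (3 * c * s - b) / 4 * x) := by
    positivity
  have e₅ : 0 ≤ c * y ^ 2 := by positivity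
  have ha' : a = (2 * c * s ^ 2 - b * s) / 3 := by linarith
  subst ha'
  linarith

/-- There are `δ₀, γ₁ > 0` such that `f(Q) ≥ γ₁ dist(Q, N)²` whenever `Q ∈ Sym₀` satisfies
`dist(Q, N) ≤ δ₀`, where `C` is the constant normalizing `min f = 0` on `Sym₀`. -/
theorem statement3 (a b c C : ℝ) (ha : 0 < a) (hb : 0 < b) (hc : 0 < c)
    (hC0 : ∀ Q ∈ Sym0, 0 ≤ fLdG a b c C Q)
    (hC1 : ∃ Q ∈ Sym0, fLdG a b c C Q = 0) :
    ∃ δ₀ > (0 : ℝ), ∃ γ₁ > (0 : ℝ), ∀ Q ∈ Sym0,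
      distN a b c Q ≤ δ₀ → γ₁ * distN a b c Q ^ 2 ≤ fLdG a b c C Q := by
  have hs := sstar_pos (a := a) hb hc
  have hq := sstar_quadratic (b := b) ha hc
  have hC := hC0 _ (uniax_mem_Sym0 unitVec_basis (sstar a b c))
  rw [fLdG_of_mulVec_eq_smul a b c C (uniax_mem_Sym0 unitVec_basis _).2 unitVec_basis
    (uniax_mulVec unitVec_basis _), trace_uniax_sq unitVec_basis] at hC
  set s := sstar a b c with hsdef
  set h := b * s / 3 / (b + 2 * c * s) with hhdef
  have hh0 : 0 < h := by positivity
  have hh : h * (b + 2 * c * s) = b * s / 3 := div_mul_cancel₀ _ (by positivity)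
  have hβ : 0 < 3 * c * s - b := by
    have : 0 < s * (3 * c * s - b) := by nlinarith [mul_pos hb hs]
    exact pos_of_mul_pos_right this hs.le
  have hγ : 0 < min (s * (3 * c * s - b) / 18) (b * s / 3) := lt_min (by positivity) (by positivity)
  refine ⟨h / 2, by positivity, _, hγ, fun Q hQ hd => ?_⟩
  obtain ⟨m, hm, hlt⟩ := exists_nrm_sub_uniax_lt (hd.trans_lt (half_lt_self hh0))
  rw [← hsdef] at hlt
  obtain ⟨n, hn, x, hmx, hx⟩ := exists_eigenvector_ge hQ.1 hm
  have hray := (abs_le.mp (abs_dotProduct_mulVec_le_nrm (hQ.1.sub (uniax_isSymm s m)) hm)).1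
  rw [sub_mulVec, dotProduct_sub, dotProduct_uniax_mulVec hm] at hray
  have hnx : n ⬝ᵥ Q *ᵥ n = x := by
    rw [hx, dotProduct_smul, hn.dotProduct_self, smul_eq_mul, mul_one]
  have hT := trace_mul_self_nonneg (hQ.1.sub (uniax_isSymm (3 / 2 * x) n))
  rw [trace_sub_uniax_sq hQ.2 hn, hnx] at hT
  rw [fLdG_of_mulVec_eq_smul a b c C hQ.2 hn hx]
  refine le_trans (mul_le_mul_of_nonneg_left ?_ hγ.le)
    (scalar_lower_bound hb hc hs hq ha (by linarith) (by linarith) hh (by linarith))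
  rw [← hnx, ← trace_sub_uniax_sq hQ.2 hn s, ← nrm_sq (hQ.1.sub (uniax_isSymm s n))]
  exact pow_le_pow_left₀ (distN_nonneg a b c Q) (distN_le a b c Q hn) 2

end
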